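/- arXiv:1212.5522 — 3 statements merged into one kernel-verified Lean document; each statement's English description precedes it below -/
import Mathlib

section
/- Let p be a prime, α, β ≥ 1, x_0 ∈ ℤ, and set d := p^α − 1 + (β−1)(p−1)p^{α−1}. Then for every x ∈ ℤ, the following identity holds in ZMod(p^β): (1 if x ≡ x_0 (mod p^α), else 0) = Σ_{δ=0}^{d} coChoose_{p^α}(δ, δ − x_0) · binom(x, δ), where coChoose_{p^α}(δ, δ − x_0) ∈ ℤ and binom(x,δ) ∈ ℤ are cast into ZMod(p^β). In other words, the Lagrange function on ZMod(p^α) with values in ZMod(p^β) is a polyfract of degree at most d with these explicit coefficients. -/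
/-- The integer binomial coefficient `binom(x,δ) = x(x-1)⋯(x-δ+1)/δ!`. -/
noncomputable def ibinom (x : ℤ) (δ : ℕ) : ℤ := Ring.choose x δ

/-- The co-monofract value `coChoose q d y = Σ_{0 ≤ j ≤ d, j ≡ y (mod q)} (−1)^j · C(d,j)`. -/
def coChoose (q d : ℕ) (y : ℤ) : ℤ :=
  ∑ j ∈ Finset.range (d + 1),
    if (q : ℤ) ∣ ((j : ℤ) - y) then (-1) ^ j * (d.choose j : ℤ) else 0

open Polynomial in
lemma aux_cyc {R : Type*} [CommRing R] (p : ℕ) (hp : p.Prime) (k : ℕ) (x : R) :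
    ∃ g : R, (x - 1) ^ (p ^ k * (p - 1)) = ∑ i ∈ Finset.range p, (x ^ p ^ k) ^ i + p * g := by
  haveI := Fact.mk hp
  have h : (C (p : ℤ)) ∣ ((X - 1) ^ (p ^ k * (p - 1)) - cyclotomic (p ^ (k + 1)) ℤ : ℤ[X]) := by
    rw [C_dvd_iff_dvd_coeff]
    intro i
    rw [← ZMod.intCast_zmod_eq_zero_iff_dvd _ p]
    have h1 : Polynomial.map (Int.castRingHom (ZMod p))
        ((X - 1) ^ (p ^ k * (p - 1)) - cyclotomic (p ^ (k + 1)) ℤ : ℤ[X]) = 0 := by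
      have h2 := cyclotomic_mul_prime_pow_eq (ZMod p) (p := p) (m := 1)
        (by simpa using hp.one_lt.ne') (k := k + 1) (Nat.succ_pos k)
      rw [mul_one, cyclotomic_one] at h2
      have h3 : p ^ (k + 1) - p ^ (k + 1 - 1) = p ^ k * (p - 1) := by
        simp [pow_succ, Nat.mul_sub]
      rw [h3] at h2
      simp [map_cyclotomic, h2]
    have h4 := congrArg (fun f => f.coeff i) h1
    simpa only [coeff_map, coeff_zero, eq_intCast] using h4
  obtain ⟨g, hg⟩ := h
  refine ⟨aeval x g, ?_⟩
  have := congrArg (aeval x) hg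
  rw [cyclotomic_prime_pow_eq_geom_sum hp] at this
  simp at this
  linear_combination this

lemma aux_dvd {R : Type*} [CommRing R] (p : ℕ) (hp : p.Prime) (k b : ℕ) (x : R)
    (hx : x ^ p ^ (k + 1) = 1) :
    (p : R) ^ (b + 1) ∣ (x - 1) ^ (p ^ k + (b + 1) * (p ^ k * (p - 1))) := by
  obtain ⟨g, hg⟩ := aux_cyc p hp k x
  obtain ⟨r, hr⟩ := exists_add_pow_prime_pow_eq hp (x - 1) 1 k
  set Y := x ^ p ^ k with hY
  set P := ∑ i ∈ Finset.range p, Y ^ i with hP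
  have hYp : Y ^ p = 1 := by rw [hY, ← pow_mul, ← pow_succ, hx]
  have h0 : P * (Y - 1) = 0 := by rw [hP, geom_sum_mul, hYp, sub_self]
  have hPi : ∀ i, P * Y ^ i = P := by
    intro i
    induction i with
    | zero => simp
    | succ n ih => rw [pow_succ]; linear_combination Y * ih + h0
  have hPP : P * P = p * P := by
    conv_lhs => rw [hP, ← hP, Finset.mul_sum]
    rw [Finset.sum_congr rfl (fun i _ => hPi i)]
    simp
  have hw : ∀ n : ℕ, ∃ a c : R, (P + p * g) ^ (n + 1) = (p : R) ^ n * (P * a + p * c) := by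
    intro n
    induction n with
    | zero => exact ⟨1, g, by ring⟩
    | succ n ih =>
      obtain ⟨a, c, h⟩ := ih
      refine ⟨a + c + a * g, c * g, ?_⟩
      rw [pow_succ, h]
      linear_combination (p : R) ^ n * a * hPP
  have hv : ∀ n : ℕ, (Y - 1) * (P + p * g) ^ n = (Y - 1) * (p * g) ^ n := by
    intro n
    induction n with
    | zero => simp
    | succ n ih => rw [pow_succ, pow_succ]; linear_combination (P + p * g) * ih + (p * g) ^ n * h0
  obtain ⟨a, c, hac⟩ := hw b
  have hu : (x - 1) ^ p ^ k = (Y - 1) - p * ((x - 1) * r) := by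
    rw [sub_add_cancel, ← hY] at hr
    rw [hr]; ring
  rw [pow_add (x - 1), mul_comm (b + 1), pow_mul (x - 1), hg, hu, sub_mul, hv, hac]
  exact ⟨(Y - 1) * g ^ (b + 1) - (x - 1) * r * (P * a + p * c), by ring⟩

lemma aux_step {R : Type*} [CommRing R] (d : ℕ) (u : R) (hu : u ^ (d + 1) = 0) (n : ℤ) :
    ∑ δ ∈ Finset.range (d + 1), (ibinom (n + 1) δ : R) * u ^ δ =
      (u + 1) * ∑ δ ∈ Finset.range (d + 1), (ibinom n δ : R) * u ^ δ := by
  have h1 : ∀ m : ℤ, ∑ δ ∈ Finset.range (d + 1), (ibinom m δ : R) * u ^ δ =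
      ∑ δ ∈ Finset.range d, (ibinom m (δ + 1) : R) * u ^ (δ + 1) + 1 := by
    intro m; rw [Finset.sum_range_succ']; simp [ibinom]
  have h2 : u * ∑ δ ∈ Finset.range (d + 1), (ibinom n δ : R) * u ^ δ =
      ∑ δ ∈ Finset.range d, (ibinom n δ : R) * u ^ (δ + 1) := by
    rw [Finset.sum_range_succ, mul_add, Finset.mul_sum]
    have : u * ((ibinom n d : R) * u ^ d) = 0 := by
      linear_combination (ibinom n d : R) * hu
    rw [this, add_zero]
    exact Finset.sum_congr rfl (fun i _ => by ring)
  rw [add_mul, one_mul, h2, h1, h1, ← add_assoc, ← Finset.sum_add_distrib]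
  congr 1
  refine Finset.sum_congr rfl (fun i _ => ?_)
  have : ibinom (n + 1) (i + 1) = ibinom n i + ibinom n (i + 1) := Ring.choose_succ_succ n i
  rw [this]; push_cast; ring

lemma aux_newton {R : Type*} [CommRing R] (d : ℕ) (X : Rˣ) (hu : ((X : R) - 1) ^ (d + 1) = 0)
    (n : ℤ) :
    ∑ δ ∈ Finset.range (d + 1), (ibinom n δ : R) * ((X : R) - 1) ^ δ = ((X ^ n : Rˣ) : R) := by
  have hs := aux_step d ((X : R) - 1) hu
  rw [sub_add_cancel] at hs
  induction n using Int.induction_on with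
  | zero =>
    rw [Finset.sum_range_succ']
    simp [ibinom, Ring.choose_zero_succ]
  | succ i ih => rw [hs, ih, zpow_add_one, mul_comm]; simp
  | pred i ih =>
    have := hs (-(i : ℤ) - 1)
    rw [sub_add_cancel, ih] at this
    rw [zpow_sub_one, Units.val_mul, this]
    rw [mul_comm, Units.inv_mul_cancel_left]

theorem stmt_9 (p : ℕ) (hp : p.Prime) (α β : ℕ) (hα : 1 ≤ α) (hβ : 1 ≤ β) (x₀ : ℤ) :
    ∀ x : ℤ,
      (if ((p : ℤ) ^ α) ∣ (x - x₀) then (1 : ZMod (p ^ β)) else 0) =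
        ∑ δ ∈ Finset.range (p ^ α - 1 + (β - 1) * (p - 1) * p ^ (α - 1) + 1),
          ((coChoose (p ^ α) δ ((δ : ℤ) - x₀) : ℤ) : ZMod (p ^ β)) *
            ((ibinom x δ : ℤ) : ZMod (p ^ β)) := by
  intro x
  obtain ⟨k, rfl⟩ : ∃ k, α = k + 1 := ⟨α - 1, by omega⟩
  obtain ⟨b, rfl⟩ : ∃ b, β = b + 1 := ⟨β - 1, by omega⟩
  simp only [Nat.add_sub_cancel]
  set d := p ^ (k + 1) - 1 + b * (p - 1) * p ^ k with hd
  let A := AddMonoidAlgebra (ZMod (p ^ (b + 1))) (ZMod (p ^ (k + 1)))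
  let s : ZMod (p ^ (k + 1)) → A := fun m => AddMonoidAlgebra.single m 1
  have hs0 : s 0 = 1 := rfl
  have hsmul : ∀ m n, s m * s n = s (m + n) := by
    intro m n
    exact (AddMonoidAlgebra.single_mul_single m n 1 1).trans (by rw [mul_one])
  let X : Aˣ := ⟨s 1, s (-1), by rw [hsmul, ← hs0]; simp, by rw [hsmul, ← hs0]; simp⟩
  have hXnat : ∀ n : ℕ, (X : A) ^ n = s n := by
    intro n
    induction n with
    | zero => simp [hs0]
    | succ n ih => rw [pow_succ, ih]; simp [X, hsmul]
  have hXint : ∀ n : ℤ, ((X ^ n : Aˣ) : A) = s n := by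
    intro n
    induction n using Int.induction_on with
    | zero => simp [hs0]
    | succ n ih => rw [zpow_add_one, Units.val_mul, ih]; simp [X, hsmul]
    | pred n ih => rw [zpow_sub_one, Units.val_mul, ih]; simp [X, hsmul, sub_eq_add_neg]
  have hnil : ((X : A) - 1) ^ (d + 1) = 0 := by
    have h1 := aux_dvd p hp k b (X : A) (by rw [hXnat, ZMod.natCast_self, hs0])
    have h2 : p ^ k + (b + 1) * (p ^ k * (p - 1)) = d + 1 := by
      obtain ⟨m, rfl⟩ : ∃ m, p = m + 1 := ⟨p - 1, by have := hp.pos; omega⟩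
      have : 0 < (m + 1) ^ (k + 1) := by positivity
      rw [hd, show (m + 1) ^ (k + 1) - 1 + b * (m + 1 - 1) * (m + 1) ^ k + 1
        = (m + 1) ^ (k + 1) + b * (m + 1 - 1) * (m + 1) ^ k by omega]
      simp only [Nat.add_sub_cancel]
      ring
    have h3 : (p : A) ^ (b + 1) = 0 := by
      rw [← Nat.cast_pow, ← map_natCast (algebraMap (ZMod (p ^ (b + 1))) A), ZMod.natCast_self,
        map_zero]
    rw [h2, h3, zero_dvd_iff] at h1
    exact h1
  have key := aux_newton d X hnil x
  rw [hXint] at key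
  let co : A →+ ZMod (p ^ (b + 1)) :=
    (Finsupp.applyAddHom (x₀ : ZMod (p ^ (k + 1)))).comp
      (AddMonoidAlgebra.coeffAddEquiv).toAddMonoidHom
  have hco : ∀ m, co (s m) = if m = (x₀ : ZMod (p ^ (k + 1))) then 1 else 0 := by
    intro m
    change (Finsupp.single m (1 : ZMod (p ^ (b + 1)))) (x₀ : ZMod (p ^ (k + 1))) = _
    rw [Finsupp.single_apply]
  have hdvd : ∀ m n : ℤ, (m : ZMod (p ^ (k + 1))) = n ↔ ((p ^ (k + 1) : ℕ) : ℤ) ∣ m - n := by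
    intro m n
    rw [← sub_eq_zero, ← Int.cast_sub, ZMod.intCast_zmod_eq_zero_iff_dvd]
  have hpow : ∀ δ : ℕ, co (((X : A) - 1) ^ δ) =
      ((coChoose (p ^ (k + 1)) δ ((δ : ℤ) - x₀) : ℤ) : ZMod (p ^ (b + 1))) := by
    intro δ
    rw [sub_eq_neg_add, add_pow, map_sum, coChoose, Int.cast_sum]
    refine Finset.sum_congr rfl (fun j hj => ?_)
    have hj' : j ≤ δ := by simpa [Nat.lt_succ_iff] using hj
    have h1 : (-1 : A) ^ j * (X : A) ^ (δ - j) * (δ.choose j : A) =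
        ((-1) ^ j * (δ.choose j : ℤ) : ℤ) • s ((δ - j : ℕ) : ZMod (p ^ (k + 1))) := by
      rw [hXnat, zsmul_eq_mul]; push_cast; ring
    rw [h1, map_zsmul, hco]
    have h2 : (((δ - j : ℕ) : ZMod (p ^ (k + 1))) = (x₀ : ZMod (p ^ (k + 1)))) ↔
        ((p ^ (k + 1) : ℕ) : ℤ) ∣ (j : ℤ) - ((δ : ℤ) - x₀) := by
      rw [← Int.cast_natCast (δ - j), hdvd, Nat.cast_sub hj', ← dvd_neg]
      ring_nf
    simp only [h2]
    split_ifs <;> simp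
  have fin := congrArg co key
  rw [map_sum, hco] at fin
  have h4 := hdvd x x₀
  push_cast at h4
  simp only [h4] at fin
  rw [← fin]
  refine Finset.sum_congr rfl (fun δ _ => ?_)
  rw [← zsmul_eq_mul, map_zsmul, hpow, zsmul_eq_mul, mul_comm]
end

section
/- Let p be a prime, n ≥ 1, α_1,…,α_n ≥ 1 and β ≥ 1, and let f : ℤ^n → ZMod(p^β) be a function that is p^{α_j}-periodic in the j-th variable for each j. For each multi-index δ ∈ ℕ^n define the coefficient P_δ := Σ_x (∏_{j=1}^{n} coChoose_{p^{α_j}}(δ_j, δ_j − x_j)) · f(x) ∈ ZMod(p^β), where x ranges over ∏_j {0,1,…,p^{α_j}−1} ⊆ ℤ^n and the integer values are cast into ZMod(p^β). Set d_j := p^{α_j} − 1 + (β−1)(p−1)p^{α_j−1} and [d] := {0,…,d_1} × ⋯ × {0,…,d_n}. Then for every x ∈ ℤ^n, f(x) = Σ_{δ ∈ [d]} P_δ · ∏_{j} binom(x_j, δ_j) in ZMod(p^β). -/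
/-- The operator-level nilpotency in a commutative ring. -/
lemma aux_ring {R : Type*} [CommRing R] (p : ℕ) (hp : p.Prime) (a k : ℕ) (E : R)
    (hE : E ^ p ^ (a + 1) = 1) :
    (p : R) ^ k ∣ (E - 1) ^ (p ^ a * (1 + k * (p - 1))) := by
  obtain ⟨c, hc⟩ := exists_add_pow_prime_pow_eq hp (E - 1) 1 a
  obtain ⟨g, hg⟩ := exists_add_pow_prime_eq hp (E ^ p ^ a - 1) 1
  have hp2 := hp.two_le
  obtain ⟨t, rfl⟩ : ∃ t, p = t + 2 := ⟨p - 2, by omega⟩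
  simp only [sub_add_cancel, one_pow, mul_one] at hc hg
  rw [← pow_mul, ← pow_succ, hE] at hg
  set P : R := ((t + 2 : ℕ) : R) with hP
  set w := E ^ (t + 2) ^ a - 1 with hw
  have hv : (E - 1) ^ (t + 2) ^ a = w + P * (-((E - 1) * c)) := by
    rw [hw, hc]; ring
  have hwp : w ^ (t + 2) = P * (w * (-g)) := by
    linear_combination -hg
  have key : ∀ m j : ℕ, P ^ m ∣ w ^ (1 + m * (t + 1) + j) := by
    intro m
    induction m with
    | zero => intro j; simp
    | succ m ih =>
      intro j
      have : w ^ (1 + (m + 1) * (t + 1) + j) = P * (w ^ (1 + m * (t + 1) + j) * (-g)) := by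
        have e : 1 + (m + 1) * (t + 1) + j = (t + 2) + (m * (t + 1) + j) := by ring
        rw [e, pow_add, hwp]; ring
      rw [this, pow_succ, mul_comm (P ^ m)]
      exact mul_dvd_mul_left _ (Dvd.dvd.mul_right (ih j) _)
  rw [pow_mul, hv, add_pow]
  have ht : t + 2 - 1 = t + 1 := rfl
  rw [ht]
  apply Finset.dvd_sum
  intro j hj
  rw [Finset.mem_range] at hj
  apply Dvd.dvd.mul_right
  rw [mul_pow, ← mul_assoc]
  apply Dvd.dvd.mul_right
  by_cases hk : k ≤ 1 + k * (t + 1) - j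
  · exact Dvd.dvd.mul_left (pow_dvd_pow _ hk) _
  · -- m = k - (M - j)
    push Not at hk
    obtain ⟨s, hs⟩ : ∃ s, s = 1 + k * (t + 1) - j := ⟨_, rfl⟩
    rw [← hs] at hk ⊢
    obtain ⟨m, rfl⟩ : ∃ m, k = m + s := ⟨k - s, by omega⟩
    have hj' : j = 1 + m * (t + 1) + s * t := by
      have : j + s = 1 + (m + s) * (t + 1) := by omega
      have h2 : (m + s) * (t + 1) = m * (t + 1) + s * t + s := by ring
      omega
    rw [pow_add, hj']
    exact mul_dvd_mul_right (key m _) _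

/-- Polynomial version. -/
lemma aux_poly (p : ℕ) (hp : p.Prime) (a k : ℕ) :
    ∃ u v : Polynomial ℤ, (Polynomial.X - 1) ^ (p ^ a * (1 + k * (p - 1))) =
      (p : Polynomial ℤ) ^ k * u + v * (Polynomial.X ^ p ^ (a + 1) - 1) := by
  let I : Ideal (Polynomial ℤ) := Ideal.span {Polynomial.X ^ p ^ (a + 1) - 1}
  have h1 : (Ideal.Quotient.mk I Polynomial.X) ^ p ^ (a + 1) = 1 := by
    rw [← map_pow, ← map_one (Ideal.Quotient.mk I), Ideal.Quotient.eq]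
    exact Ideal.subset_span rfl
  obtain ⟨u, hu⟩ := aux_ring p hp a k _ h1
  obtain ⟨u, rfl⟩ := Ideal.Quotient.mk_surjective u
  have h2 : Ideal.Quotient.mk I ((Polynomial.X - 1) ^ (p ^ a * (1 + k * (p - 1)))) =
      Ideal.Quotient.mk I ((p : Polynomial ℤ) ^ k * u) := by
    simpa using hu
  rw [Ideal.Quotient.eq, Ideal.mem_span_singleton'] at h2
  obtain ⟨v, hv⟩ := h2
  exact ⟨u, v, by rw [hv]; ring⟩

lemma aux_nil (p : ℕ) (hp : p.Prime) (a k : ℕ) (g : ℤ → ZMod (p ^ k))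
    (hg : ∀ x, g (x + p ^ (a + 1)) = g x) :
    (fwdDiff (1 : ℤ))^[p ^ a * (1 + k * (p - 1))] g = 0 := by
  obtain ⟨u, v, h⟩ := aux_poly p hp a k
  have h' := congrArg (fun P => Polynomial.aeval
    (fwdDiff_aux.shiftₗ ℤ (ZMod (p ^ k)) 1) P g) h
  have e1 : fwdDiff_aux.shiftₗ ℤ (ZMod (p ^ k)) 1 - 1 =
    fwdDiff_aux.fwdDiffₗ ℤ (ZMod (p ^ k)) 1 := by simp [fwdDiff_aux.shiftₗ]
  have e2 : (fwdDiff_aux.shiftₗ ℤ (ZMod (p ^ k)) 1 ^ (p ^ (a + 1))) g = g := by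
    ext y
    rw [fwdDiff_aux.shiftₗ_pow_apply]
    simpa using hg y
  simp only [map_add, map_mul, map_pow, map_sub, map_one, Polynomial.aeval_X, map_natCast, e1,
    LinearMap.add_apply, Module.End.mul_apply, LinearMap.sub_apply, e2, Module.End.one_apply,
    sub_self, map_zero, add_zero] at h'
  rw [← fwdDiff_aux.coe_fwdDiffₗ_pow, h', ← Nat.cast_pow]
  ext y
  rw [Module.End.natCast_apply, Pi.smul_apply, nsmul_eq_mul, ZMod.natCast_self, zero_mul]
  rfl

lemma aux_newton_s11 {A : Type*} [CommRing A] (q : ℤ) (d : ℕ)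
    (H : ∀ g : ℤ → A, (∀ x, g (x + q) = g x) → (fwdDiff (1 : ℤ))^[d + 1] g = 0) (x : ℤ) :
    ∀ g : ℤ → A, (∀ x, g (x + q) = g x) →
      g x = ∑ k ∈ Finset.range (d + 1), (fwdDiff (1 : ℤ))^[k] g 0 * ((Ring.choose x k : ℤ) : A) := by
  have step : ∀ (x : ℤ) (g : ℤ → A), (∀ x, g (x + q) = g x) →
      ∑ k ∈ Finset.range (d + 1), (fwdDiff (1 : ℤ))^[k] (fun y => g (y + 1)) 0 *
        ((Ring.choose x k : ℤ) : A) =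
      ∑ k ∈ Finset.range (d + 1), (fwdDiff (1 : ℤ))^[k] g 0 *
        ((Ring.choose (x + 1) k : ℤ) : A) := by
    intro x g hg
    have h1 : ∀ k, (fwdDiff (1 : ℤ))^[k] (fun y => g (y + 1)) 0 =
        (fwdDiff (1 : ℤ))^[k] g 0 + (fwdDiff (1 : ℤ))^[k + 1] g 0 := by
      intro k
      rw [fwdDiff_iter_comp_add, Function.iterate_succ_apply', fwdDiff]
      ring
    have h2 : (fwdDiff (1 : ℤ))^[d + 1] g 0 = 0 := by rw [H g hg]; rfl
    simp only [h1, add_mul, Finset.sum_add_distrib]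
    rw [Finset.sum_range_succ' (fun k => (fwdDiff (1 : ℤ))^[k] g 0 * ((Ring.choose x k : ℤ) : A)),
      Finset.sum_range_succ (fun k => (fwdDiff (1 : ℤ))^[k+1] g 0 * ((Ring.choose x k : ℤ) : A)),
      h2, Finset.sum_range_succ' (fun k => (fwdDiff (1 : ℤ))^[k] g 0 *
        ((Ring.choose (x + 1) k : ℤ) : A))]
    simp only [Ring.choose_succ_succ, Ring.choose_zero_right, Int.cast_add, mul_add,
      Finset.sum_add_distrib]
    ring
  induction x using Int.induction_on with
  | zero =>
    intro g _
    rw [Finset.sum_range_succ']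
    simp
  | succ i ih =>
    intro g hg
    rw [← step _ g hg]
    exact ih (fun y => g (y + 1)) (fun x => by rw [add_right_comm, hg])
  | pred i ih =>
    intro g hg
    have hg' : ∀ x, (fun y => g (y - 1)) (x + q) = (fun y => g (y - 1)) x := fun x => by
      simp only
      rw [add_sub_right_comm, hg]
    have h1 := ih (fun y => g (y - 1)) hg'
    have h2 := step (-(i : ℤ) - 1) (fun y => g (y - 1)) hg'
    simp only [add_sub_cancel_right, sub_add_cancel] at h2
    rw [h2, ← h1]

lemma aux_coChoose {A : Type*} [CommRing A] (q k : ℕ) (z : ℤ) :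
    ((coChoose q k ((k : ℤ) - z) : ℤ) : A) =
      (fwdDiff (1 : ℤ))^[k] (fun x : ℤ => if (q : ℤ) ∣ x - z then (1 : A) else 0) 0 := by
  rw [fwdDiff_iter_eq_sum_shift, coChoose, ← Finset.sum_range_reflect, Int.cast_sum]
  apply Finset.sum_congr rfl
  intro j hj
  have hj : j ≤ k := by simpa [Nat.lt_succ_iff] using hj
  have e : k + 1 - 1 - j = k - j := by omega
  have e2 : ((k - j : ℕ) : ℤ) - ((k : ℤ) - z) = -((j : ℤ) - z) := by
    rw [Nat.cast_sub hj]; ring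
  rw [e, e2, Nat.choose_symm hj]
  simp only [dvd_neg, zero_add, nsmul_eq_mul, mul_one]
  split_ifs <;> simp

lemma aux_one (p : ℕ) (hp : p.Prime) (α β : ℕ) (hα : 1 ≤ α) (hβ : 1 ≤ β) (x z : ℤ) :
    ∑ k ∈ Finset.range (p ^ α - 1 + (β - 1) * (p - 1) * p ^ (α - 1) + 1),
      ((coChoose (p ^ α) k ((k : ℤ) - z) : ℤ) : ZMod (p ^ β)) *
        ((ibinom x k : ℤ) : ZMod (p ^ β)) =
      if ((p ^ α : ℕ) : ℤ) ∣ x - z then 1 else 0 := by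
  obtain ⟨a, rfl⟩ : ∃ a, α = a + 1 := ⟨α - 1, by omega⟩
  obtain ⟨b, rfl⟩ : ∃ b, β = b + 1 := ⟨β - 1, by omega⟩
  have hd : p ^ (a + 1) - 1 + (b + 1 - 1) * (p - 1) * p ^ (a + 1 - 1) + 1 =
      p ^ a * (1 + (b + 1) * (p - 1)) := by
    have h0 : 0 < p ^ (a + 1) := pow_pos hp.pos _
    obtain ⟨t, rfl⟩ : ∃ t, p = t + 1 := ⟨p - 1, by have := hp.pos; omega⟩
    simp only [Nat.add_sub_cancel]
    rw [add_right_comm, Nat.sub_add_cancel h0]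
    ring
  simp only [aux_coChoose, ibinom]
  refine (aux_newton_s11 (A := ZMod (p ^ (b + 1))) ((p ^ (a + 1) : ℕ) : ℤ) _ ?_ x
    (fun x : ℤ => if ((p ^ (a + 1) : ℕ) : ℤ) ∣ x - z then 1 else 0) ?_).symm
  · intro g hg
    rw [hd]
    exact aux_nil p hp a (b + 1) g (by simpa using hg)
  · intro x
    simp only [add_sub_right_comm x, dvd_add_self_right]

lemma aux_periodic {n : ℕ} {A : Type*} (q : Fin n → ℤ) (f : (Fin n → ℤ) → A)
    (hper : ∀ (x : Fin n → ℤ) (j : Fin n), f (Function.update x j (x j + q j)) = f x)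
    (x y : Fin n → ℤ) (h : ∀ j, q j ∣ x j - y j) : f x = f y := by
  have h1 : ∀ (j : Fin n) (k : ℤ) (x : Fin n → ℤ),
      f (Function.update x j (x j + k * q j)) = f x := by
    intro j k
    induction k using Int.induction_on with
    | zero => intro x; simp
    | succ i ih =>
      intro x
      rw [← ih x, ← hper (Function.update x j (x j + i * q j)) j]
      simp only [Function.update_idem, Function.update_self]
      congr 2; ring
    | pred i ih =>
      intro x
      rw [← ih x, ← hper (Function.update x j (x j + (-(i : ℤ) - 1) * q j)) j]
      simp only [Function.update_idem, Function.update_self]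
      congr 2; ring
  have h2 : ∀ s : Finset (Fin n), f (s.piecewise x y) = f y := by
    intro s
    induction s using Finset.induction_on with
    | empty => simp
    | insert j s hj ih =>
      obtain ⟨k, hk⟩ := h j
      rw [Finset.piecewise_insert, ← ih, ← h1 j k (s.piecewise x y)]
      congr 2
      rw [Finset.piecewise_eq_of_notMem _ _ _ hj]
      linarith
  simpa using h2 Finset.univ

/-- Interpolation theorem: a map `f : ℤ^n → ZMod(p^β)` that is `p^{α_j}`-periodic in the
`j`-th variable is interpolated by the polyfract with coefficients
`P_δ = Σ_x (∏_j coChoose_{p^{α_j}}(δ_j, δ_j − x_j)) · f(x)`, the summation for `δ` ranging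
over the grid `[d]` with `d_j := p^{α_j} − 1 + (β−1)(p−1)p^{α_j−1}`. -/
theorem stmt_11 (p : ℕ) (hp : p.Prime) (n : ℕ) (hn : 1 ≤ n) (α : Fin n → ℕ)
    (hα : ∀ j, 1 ≤ α j) (β : ℕ) (hβ : 1 ≤ β)
    (f : (Fin n → ℤ) → ZMod (p ^ β))
    (hper : ∀ (x : Fin n → ℤ) (j : Fin n),
      f (Function.update x j (x j + p ^ α j)) = f x) :
    ∀ x : Fin n → ℤ,
      f x = ∑ δ ∈ Fintype.piFinset
          (fun j => Finset.range (p ^ α j - 1 + (β - 1) * (p - 1) * p ^ (α j - 1) + 1)),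
        (∑ y ∈ Fintype.piFinset (fun j => Finset.range (p ^ α j)),
            (((∏ j, coChoose (p ^ α j) (δ j) ((δ j : ℤ) - (y j : ℤ))) : ℤ) : ZMod (p ^ β)) *
              f (fun j => (y j : ℤ))) *
          ∏ j, ((ibinom (x j) (δ j) : ℤ) : ZMod (p ^ β)) := by
  intro x
  have hq : ∀ j, 0 < p ^ α j := fun j => pow_pos hp.pos _
  symm
  calc _ = ∑ y ∈ Fintype.piFinset (fun j => Finset.range (p ^ α j)),
        (∏ j, if ((p ^ α j : ℕ) : ℤ) ∣ x j - (y j : ℤ) then (1 : ZMod (p ^ β)) else 0) *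
          f (fun j => (y j : ℤ)) := by
        simp only [← aux_one p hp (α _) β (hα _) hβ, Finset.prod_univ_sum, Finset.sum_mul]
        rw [Finset.sum_comm]
        refine Finset.sum_congr rfl fun y _ => Finset.sum_congr rfl fun δ _ => ?_
        rw [Finset.prod_mul_distrib, Int.cast_prod]
        ring
    _ = f x := by
        have hz : ∀ j, (((x j % ((p ^ α j : ℕ) : ℤ)).toNat : ℕ) : ℤ) =
            x j % ((p ^ α j : ℕ) : ℤ) := fun j =>
          Int.toNat_of_nonneg (Int.emod_nonneg _ (by have := hq j; omega))
        rw [Finset.sum_eq_single (fun j => (x j % ((p ^ α j : ℕ) : ℤ)).toNat)]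
        · rw [Finset.prod_eq_one, one_mul]
          · apply aux_periodic (fun j => ((p ^ α j : ℕ) : ℤ)) f (by simpa using hper)
            intro j
            rw [hz, dvd_sub_comm]
            exact Int.dvd_self_sub_emod
          · intro j _
            rw [hz, if_pos Int.dvd_self_sub_emod]
        · intro y hy hne
          obtain ⟨j, hj⟩ := Function.ne_iff.mp hne
          rw [Finset.prod_eq_zero (Finset.mem_univ j), zero_mul]
          rw [if_neg]
          intro hdvd
          apply hj
          have hyj : y j < p ^ α j := by simpa using Fintype.mem_piFinset.mp hy j
          have h3 := (Int.emod_emod_of_dvd (x j) (dvd_refl ((p ^ α j : ℕ) : ℤ)))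
          have h4 : x j % ((p ^ α j : ℕ) : ℤ) = (y j : ℤ) % ((p ^ α j : ℕ) : ℤ) :=
            Int.emod_eq_emod_iff_emod_sub_eq_zero.mpr (Int.emod_eq_zero_of_dvd hdvd)
          rw [h4, Int.emod_eq_of_lt (by positivity) (by exact_mod_cast hyj)]
          simp
        · intro hnot
          exfalso
          apply hnot
          rw [Fintype.mem_piFinset]
          intro j
          rw [Finset.mem_range]
          have := Int.emod_lt_of_pos (x j) (b := ((p ^ α j : ℕ) : ℤ)) (by exact_mod_cast hq j)
          have := hz j
          zify
          push_cast at *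
          omega
end

section
/- Let p be a prime, n ≥ 1, α_1,…,α_n ≥ 1 and β ≥ 1, and set D := (Σ_{j=1}^{n} p^{α_j}) − n + (β−1)(p−1)p^{α_max−1}, where α_max := max_j α_j. Then: (a) every function f : ℤ^n → ZMod(p^β) that is p^{α_j}-periodic in the j-th variable for each j has a polyfract representation c : (Fin n → ℕ) → ZMod(p^β) with c(δ) = 0 whenever δ_1 + ⋯ + δ_n > D; (b) this bound is best possible: there exists such a function f all of whose polyfract representations c have c(δ) ≠ 0 for some δ with δ_1 + ⋯ + δ_n = D. -/
/-- Abstract step. -/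
theorem step_abs {A : Type*} [CommRing A] (P y g h : A) (s' t : ℕ)
    (hy : y ^ ((s' + t + 1) + (s' + 1)) = -P * y ^ (s' + 1) * (1 + y * g) + P ^ 2 * y * h) (k : ℕ) :
    ∃ u v : A, y ^ ((s' + t + 1 + s') + k * (s' + t + 1)) =
      (-P) ^ k * y ^ (s' + t + 1 + s') + P ^ (k + 1) * (y ^ (s' + 1) * u + P * y * v) := by
  induction k with
  | zero => exact ⟨0, 0, by simp⟩
  | succ k ih =>
    obtain ⟨u, v, ih⟩ := ih
    have e1 : y ^ ((s' + t + 1 + s') + (k + 1) * (s' + t + 1)) =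
      y ^ ((s' + t + 1 + s') + k * (s' + t + 1)) * y ^ (s' + t + 1) := by ring
    have e2 : y ^ (s' + t + 1 + s') * y ^ (s' + t + 1) = 
      -P * y ^ (s' + t + 1 + s') + -P * g * y ^ ((s' + t + 1) + (s' + 1)) 
        + P ^ 2 * h * y ^ (s' + t + 1) := by
      have : y ^ (s' + t + 1 + s') * y ^ (s' + t + 1) = 
        y ^ ((s' + t + 1) + (s' + 1)) * y ^ (s' + t) := by ring
      rw [this]
      nth_rw 1 [hy]; ring
    have e3 : y ^ (s' + 1) * y ^ (s' + t + 1) = y ^ ((s' + t + 1) + (s' + 1)) := by ring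
    rw [hy] at e2 e3
    have e4 : y ^ ((s' + t + 1 + s') + (k + 1) * (s' + t + 1)) = 
      (-P) ^ k * (y ^ (s' + t + 1 + s') * y ^ (s' + t + 1)) + 
      P ^ (k + 1) * ((y ^ (s' + 1) * y ^ (s' + t + 1)) * u + P * y * v * y ^ (s' + t + 1)) := by
      rw [e1, ih]; ring
    rw [e4, e2, e3]
    refine ⟨(-1) ^ k * (g * (1 + y * g) + h * y ^ t) + (- (1 + y * g) * u + y ^ (t + 1) * v),
      (-1) ^ k * (- g * h) + h * u, ?_⟩
    rw [neg_pow P k, neg_pow P (k+1)]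
    ring

theorem one_add_pow_prime {A : Type*} [CommRing A] (p : ℕ) (hp : p.Prime) (z : A) :
    ∃ c : A, (1 + z) ^ p = 1 + z ^ p + p * z * (1 + z * c) := by
  obtain ⟨m, rfl⟩ : ∃ m, p = m + 2 := ⟨p - 2, by have := hp.two_le; omega⟩
  rw [add_comm, add_pow, Finset.sum_range_succ, Finset.sum_range_succ', Finset.sum_range_succ']
  refine ⟨∑ i ∈ Finset.range m, z ^ i * ((Nat.choose (m+2) (i+2) / (m + 2) : ℕ) : A), ?_⟩
  have : ∀ i ∈ Finset.range m, z ^ (i + 1 + 1) * 1 ^ (m + 2 - (i + 1 + 1)) * ((m + 2).choose (i + 1 + 1) : A)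
     = ((m + 2 : ℕ) : A) * z * z * (z ^ i * ((Nat.choose (m+2) (i+2) / (m + 2) : ℕ) : A)) := by
    intro i hi
    have hi := Finset.mem_range.1 hi
    obtain ⟨b, hb⟩ := hp.dvd_choose_self (k := i + 2) (by omega) (by omega)
    have h2 : (m+2).choose (i+1+1) = (m+2) * b := hb
    rw [h2, Nat.mul_div_cancel_left _ (by omega)]
    push_cast; ring
  rw [Finset.sum_congr rfl this, ← Finset.mul_sum]
  simp; ring

theorem key_rel {A : Type*} [CommRing A] (p : ℕ) (hp : p.Prime) (a : ℕ) (y : A)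
    (hy : (1 + y) ^ (p ^ (a + 1)) = 1) :
    ∃ g h : A, y ^ (p ^ (a + 1)) = -(p:A) * y ^ (p ^ a) * (1 + y * g) + (p:A) ^ 2 * y * h := by
  obtain ⟨w, hw⟩ : ∃ w, (1 + y) ^ (p ^ a) = 1 + y ^ (p ^ a) + p * y * w := 
    ⟨_, by rw [add_pow_prime_pow_eq hp]; rw [one_pow, mul_one]⟩
  obtain ⟨c, hc⟩ := one_add_pow_prime p hp (y ^ (p ^ a))
  obtain ⟨k, hk⟩ := Polynomial.powAddExpansion (1 + y ^ (p ^ a)) (p * y * w) p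
  obtain ⟨s', hs⟩ : ∃ s', p ^ a = s' + 1 := ⟨p ^ a - 1, by have := Nat.pow_pos (n := a) hp.pos; omega⟩
  rw [pow_succ, pow_mul, hw, hk, hc] at hy
  rw [pow_succ, pow_mul]
  refine ⟨y ^ s' * c, - ((1 + y ^ (p ^ a)) ^ (p - 1) * w + k * y * w ^ 2), ?_⟩
  have : y * (y ^ s' * c) = y ^ (p ^ a) * c := by rw [hs]; ring
  rw [this]
  linear_combination hy

theorem key_pow {A : Type*} [CommRing A] (p : ℕ) (hp : p.Prime) (a : ℕ) (y : A)
    (hy : (1 + y) ^ (p ^ (a + 1)) = 1) (k : ℕ) :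
    (∃ r : A, y ^ (p ^ (a + 1) - 1 + k * ((p - 1) * p ^ a)) =
      (-(p:A)) ^ k * y ^ (p ^ (a + 1) - 1) + (p:A) ^ (k + 1) * r) ∧
    (p : A) ^ (k + 1) ∣ y ^ (p ^ (a + 1) + k * ((p - 1) * p ^ a)) := by
  obtain ⟨g, h, hr⟩ := key_rel p hp a y hy
  obtain ⟨s', hs⟩ : ∃ s', p ^ a = s' + 1 := ⟨p ^ a - 1, by have := Nat.pow_pos (n := a) hp.pos; omega⟩
  obtain ⟨m, rfl⟩ : ∃ m, p = m + 2 := ⟨p - 2, by have := hp.two_le; omega⟩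
  obtain ⟨t, ht⟩ : ∃ t, (m + 1) * (s' + 1) = s' + t + 1 := ⟨m * (s' + 1), by ring⟩
  have hq : (m + 2) ^ (a + 1) = (s' + t + 1) + (s' + 1) := by
    rw [pow_succ, hs, ← ht]; ring
  rw [hq, hs] at hr
  obtain ⟨u, v, H⟩ := step_abs _ y g h s' t hr k
  have e : (m + 2 - 1) * (m+2) ^ a = s' + t + 1 := by rw [hs, ← ht]; rfl
  rw [e, hq]
  have e' : (s' + t + 1) + (s' + 1) - 1 = s' + t + 1 + s' := by omega
  rw [e']
  refine ⟨⟨_, H⟩, ?_⟩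
  have : s' + t + 1 + (s' + 1) + k * (s' + t + 1) = ((s' + t + 1 + s') + k * (s' + t + 1)) + 1 := by ring
  have e5 : y ^ (s' + t + 1 + s') * y = y ^ ((s' + t + 1) + (s' + 1)) := by ring
  rw [this, pow_succ y, H, add_mul, mul_assoc, e5, hr]
  refine ⟨(-1) ^ k * (- y ^ (s' + 1) * (1 + y * g) + ((m+2 : ℕ):A) * y * h) + (y ^ (s' + 1) * u + ((m+2 : ℕ):A) * y * v) * y, ?_⟩
  rw [neg_pow _ k]; ring

theorem binom_step {A : Type*} [CommRing A] (y : A) (d : ℕ) (hd : y ^ d = 0) (x : ℤ) :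
    ∑ i ∈ Finset.range d, ((ibinom (x + 1) i : ℤ) : A) * y ^ i =
      (1 + y) * ∑ i ∈ Finset.range d, ((ibinom x i : ℤ) : A) * y ^ i := by
  cases d with
  | zero => simp
  | succ e =>
    have h0 : y * (((ibinom x e : ℤ) : A) * y ^ e) = 0 := by
      rw [mul_left_comm, ← pow_succ', hd, mul_zero]
    have hR : y * ∑ i ∈ Finset.range (e + 1), ((ibinom x i : ℤ) : A) * y ^ i =
        ∑ i ∈ Finset.range e, y * (((ibinom x i : ℤ) : A) * y ^ i) := by
      rw [Finset.sum_range_succ, mul_add, h0, add_zero, Finset.mul_sum]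
    rw [add_mul, one_mul, hR, Finset.sum_range_succ',
      Finset.sum_range_succ' (fun i => ((ibinom x i : ℤ) : A) * y ^ i) e]
    have : ∀ i, ((ibinom (x + 1) (i + 1) : ℤ) : A) * y ^ (i + 1) =
      y * (((ibinom x i : ℤ) : A) * y ^ i) + ((ibinom x (i + 1) : ℤ) : A) * y ^ (i + 1) := by
      intro i
      simp only [ibinom]
      rw [Ring.choose_succ_succ]; push_cast; ring
    simp only [this, Finset.sum_add_distrib]
    simp only [ibinom, Ring.choose_zero_right]
    ring

/-- The one-dimensional statement. -/
theorem oneD (p : ℕ) (hp : p.Prime) (a : ℕ) (β : ℕ) (hβ : 1 ≤ β) :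
    ∃ (φ : ZMod (p ^ (a + 1)) → ℕ → ZMod (p ^ β)) (d : ℕ),
      (∀ b δ, d ≤ δ → φ b δ = 0) ∧
      (∀ b (x : ℤ), (if (x : ZMod (p ^ (a + 1))) = b then (1 : ZMod (p ^ β)) else 0) =
        ∑ δ ∈ Finset.range d, ((ibinom x δ : ℤ) : ZMod (p ^ β)) * φ b δ) ∧
      (∀ b k δ, p ^ (a + 1) + k * ((p - 1) * p ^ a) ≤ δ → ((p : ZMod (p ^ β)) ^ (k + 1)) ∣ φ b δ) ∧
      φ (-1) (p ^ (a + 1) - 1) = 1 ∧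
      φ (-1) (p ^ (a + 1) - 1 + (β - 1) * ((p - 1) * p ^ a)) = (-(p : ZMod (p ^ β))) ^ (β - 1) := by
  classical
  set q := p ^ (a + 1) with hq
  have hq0 : 0 < q := Nat.pow_pos hp.pos
  let T : AddMonoidAlgebra (ZMod (p ^ β)) (ZMod q) := AddMonoidAlgebra.single 1 1
  let y : AddMonoidAlgebra (ZMod (p ^ β)) (ZMod q) := T - 1
  have hT : 1 + y = T := by simp [y]
  have hTpow : ∀ m : ℕ, T ^ m = AddMonoidAlgebra.single (m : ZMod q) 1 := by
    intro m; simp [T, AddMonoidAlgebra.single_pow]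
  have hy : (1 + y) ^ q = 1 := by
    rw [hT, hTpow]; simp [AddMonoidAlgebra.one_def]
  let co : ZMod q → (AddMonoidAlgebra (ZMod (p ^ β)) (ZMod q) →+ ZMod (p ^ β)) := fun b =>
    (Finsupp.applyAddHom b).comp (AddMonoidAlgebra.coeffAddEquiv).toAddMonoidHom
  have hco : ∀ b c, co b (AddMonoidAlgebra.single c 1) = if c = b then 1 else 0 := by
    intro b c
    change (Finsupp.single c (1 : ZMod (p ^ β))) b = _
    rw [Finsupp.single_apply]
  have hnat : ∀ b (m : ℕ) u, co b ((m : AddMonoidAlgebra (ZMod (p ^ β)) (ZMod q)) * u) = m * co b u := by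
    intro b m u; rw [← nsmul_eq_mul, map_nsmul, nsmul_eq_mul]
  have hcoInt : ∀ b (m : ℤ) u, co b ((m : AddMonoidAlgebra (ZMod (p ^ β)) (ZMod q)) * u) = m * co b u := by
    intro b m u; rw [← zsmul_eq_mul, map_zsmul, zsmul_eq_mul]
  have hp0 : ((p : AddMonoidAlgebra (ZMod (p ^ β)) (ZMod q))) ^ β = 0 := by
    have h1 : ((p ^ β : ℕ) : ZMod (p ^ β)) = 0 := ZMod.natCast_self _
    rw [← Nat.cast_pow, ← mul_one ((p ^ β : ℕ) : AddMonoidAlgebra (ZMod (p ^ β)) (ZMod q)), ← nsmul_eq_mul]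
    ext b
    change ((p ^ β) • _ : ZMod (p ^ β)) = 0
    rw [nsmul_eq_mul, h1, zero_mul]
  have hdiv : ∀ k δ, q + k * ((p - 1) * p ^ a) ≤ δ →
      (p : AddMonoidAlgebra (ZMod (p ^ β)) (ZMod q)) ^ (k + 1) ∣ y ^ δ := fun k δ h =>
    (key_pow p hp a y hy k).2.trans (pow_dvd_pow y h)
  have hyd : ∀ δ, q + (β - 1) * ((p - 1) * p ^ a) ≤ δ → y ^ δ = 0 := by
    intro δ h
    have := hdiv _ _ h
    rwa [Nat.sub_add_cancel hβ, hp0, zero_dvd_iff] at this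
  have h1 : co (-1) (y ^ (q - 1)) = 1 := by
    have : y = T + (-1) := by simp [y, sub_eq_add_neg]
    rw [this, add_pow, map_sum, Finset.sum_eq_single (q - 1)]
    · simp only [Nat.sub_self, pow_zero, Nat.choose_self, Nat.cast_one, mul_one]
      rw [hTpow, hco, if_pos]
      rw [Nat.cast_sub hq0]; simp
    · intro m hm hne
      have hm := Finset.mem_range.1 hm
      have : T ^ m * (-1) ^ (q - 1 - m) * ((q - 1).choose m : AddMonoidAlgebra (ZMod (p ^ β)) (ZMod q))
        = (((-1) ^ (q - 1 - m) * ((q - 1).choose m) : ℤ) : AddMonoidAlgebra (ZMod (p ^ β)) (ZMod q)) * T ^ m := by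
        push_cast; ring
      rw [this, hcoInt, hTpow, hco, if_neg, mul_zero]
      intro h
      have h2 : ((m + 1 : ℕ) : ZMod q) = 0 := by push_cast; rw [h]; ring
      rw [ZMod.natCast_eq_zero_iff] at h2
      have := Nat.le_of_dvd (by omega) h2
      omega
    · intro h; exact absurd (Finset.mem_range.2 (by omega)) h
  have hG : ∀ x : ℤ, ∑ i ∈ Finset.range (q + (β - 1) * ((p - 1) * p ^ a)), ((ibinom x i : ℤ) : AddMonoidAlgebra (ZMod (p ^ β)) (ZMod q)) * y ^ i
      = AddMonoidAlgebra.single (x : ZMod q) 1 := by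
    have hs := binom_step y _ (hyd _ le_rfl)
    intro x
    induction x using Int.induction_on with
    | zero =>
      rw [Finset.sum_eq_single 0]
      · simp [ibinom, AddMonoidAlgebra.one_def]
      · intro i _ hi
        simp only [ibinom]
        rw [Ring.choose_zero_pos ℤ (Nat.pos_of_ne_zero hi)]; simp
      · intro h; exact absurd (Finset.mem_range.2 (by omega)) h
    | succ i ih =>
      rw [hs, ih, hT]
      simp [T, AddMonoidAlgebra.single_mul_single, add_comm]
    | pred i ih =>
      have := hs (-(i:ℤ) - 1)
      rw [sub_add_cancel, ih, hT] at this
      have h3 := congrArg (fun u => AddMonoidAlgebra.single (-1 : ZMod q) (1 : ZMod (p ^ β)) * u) this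
      have h4 : AddMonoidAlgebra.single (-1 : ZMod q) (1 : ZMod (p ^ β)) * T = 1 := by
        simp [T, AddMonoidAlgebra.single_mul_single, AddMonoidAlgebra.one_def]
      rw [← mul_assoc _ T, h4, one_mul] at h3
      rw [← h3, AddMonoidAlgebra.single_mul_single]
      congr 1
      · push_cast; ring
      · simp
  refine ⟨fun b δ => co b (y ^ δ), q + (β - 1) * ((p - 1) * p ^ a), ?_, ?_, ?_, h1, ?_⟩
  · intro b δ h
    simp only
    rw [hyd δ h, map_zero]
  · intro b x
    rw [← hco, ← hG, map_sum]
    exact Finset.sum_congr rfl fun i _ => hcoInt _ _ _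
  · intro b k δ h
    obtain ⟨r, hr⟩ := hdiv k δ h
    refine ⟨co b r, ?_⟩
    simp only
    rw [hr, ← Nat.cast_pow, hnat]; simp
  · obtain ⟨r, hr⟩ := (key_pow p hp a y hy (β - 1)).1
    simp only
    rw [hr, Nat.sub_add_cancel hβ, hp0, zero_mul, add_zero]
    have := hcoInt (-1) ((-(p:ℤ)) ^ (β - 1)) (y ^ (q - 1))
    push_cast at this
    rw [this, h1, mul_one]

theorem periodic_all {n : ℕ} {R : Type*} (q : Fin n → ℕ) (f : (Fin n → ℤ) → R)
    (hf : ∀ (x : Fin n → ℤ) (j : Fin n), f (Function.update x j (x j + q j)) = f x)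
    (x m : Fin n → ℤ) : f (fun j => x j + q j * m j) = f x := by
  classical
  have h1 : ∀ (k : ℤ) (x : Fin n → ℤ) (j : Fin n), f (Function.update x j (x j + q j * k)) = f x := by
    intro k
    induction k using Int.induction_on with
    | zero => intro x j; simp
    | succ i ih =>
      intro x j
      rw [← ih x j, ← hf (Function.update x j (x j + q j * i)) j]
      simp [mul_add, add_assoc]
    | pred i ih =>
      intro x j
      rw [← ih x j, ← hf (Function.update x j (x j + q j * (-i - 1))) j]
      simp only [Function.update_self, Function.update_idem]
      congr 2; ring
  have h2 : ∀ s : Finset (Fin n), f (fun j => if j ∈ s then x j + q j * m j else x j) = f x := by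
    intro s
    induction s using Finset.induction_on with
    | empty => simp
    | insert i s hi ih =>
      rw [← ih, ← h1 (m i) (fun j => if j ∈ s then x j + q j * m j else x j) i]
      congr 1
      funext j
      by_cases hj : j = i
      · subst hj; simp [hi]
      · simp [Function.update_of_ne hj, hj]
  simpa using h2 Finset.univ

theorem rep_unique {n : ℕ} {R : Type*} [CommRing R] (c : (Fin n → ℕ) →₀ R)
    (hc : ∀ x : Fin n → ℤ, 0 = c.sum fun δ a => (∏ j, ((ibinom (x j) (δ j) : ℤ) : R)) * a) :
    c = 0 := by
  classical
  by_contra hne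
  have hs : c.support.Nonempty := Finsupp.support_nonempty_iff.2 hne
  obtain ⟨δ, hδ, hmin⟩ := Finset.exists_min_image c.support (fun δ => ∑ j, δ j) hs
  have h := hc (fun j => (δ j : ℤ))
  rw [Finsupp.sum, Finset.sum_eq_single δ] at h
  · simp [ibinom, Ring.choose_natCast] at h
    exact Finsupp.mem_support_iff.1 hδ h.symm
  · intro ε hε hne
    have : ∃ j, δ j < ε j := by
      by_contra! hle
      apply hne
      have hsum := hmin ε hε
      have := (Finset.sum_eq_sum_iff_of_le (s := Finset.univ) (f := ε) (g := δ) (fun i _ => hle i)).1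
        (le_antisymm (Finset.sum_le_sum fun i _ => hle i) hsum)
      funext j; exact this j (Finset.mem_univ j)
    obtain ⟨j, hj⟩ := this
    rw [Finset.prod_eq_zero (Finset.mem_univ j), zero_mul]
    simp [ibinom, Ring.choose_natCast, Nat.choose_eq_zero_of_lt hj]
  · intro h; exact absurd hδ h

/-- Expanding a product of one-dimensional representations. -/
theorem prod_expand {n : ℕ} {R : Type*} [CommRing R] (d : Fin n → ℕ) (ψ : Fin n → ℕ → R)
    (x : Fin n → ℤ) :
    ∏ j, ∑ δ ∈ Finset.range (d j), ((ibinom (x j) δ : ℤ) : R) * ψ j δ =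
      ∑ δ ∈ Fintype.piFinset (fun j => Finset.range (d j)),
        (∏ j, ((ibinom (x j) (δ j) : ℤ) : R)) * ∏ j, ψ j (δ j) := by
  rw [Finset.prod_univ_sum]
  exact Finset.sum_congr rfl fun δ _ => Finset.prod_mul_distrib

theorem prod_supp {n : ℕ} {R : Type*} [CommRing R] (d : Fin n → ℕ) (ψ : Fin n → ℕ → R)
    (h : ∀ j δ, d j ≤ δ → ψ j δ = 0) (δ : Fin n → ℕ)
    (hδ : δ ∉ Fintype.piFinset (fun j => Finset.range (d j))) : ∏ j, ψ j (δ j) = 0 := by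
  simp only [Fintype.mem_piFinset, Finset.mem_range, not_forall, not_lt] at hδ
  obtain ⟨j, hj⟩ := hδ
  exact Finset.prod_eq_zero (Finset.mem_univ j) (h j _ hj)

theorem onFinset_rep {n : ℕ} {R : Type*} [CommRing R] (S : Finset (Fin n → ℕ))
    (g : (Fin n → ℕ) → R) (hg : ∀ δ, g δ ≠ 0 → δ ∈ S) (x : Fin n → ℤ) :
    ((Finsupp.onFinset S g hg).sum fun δ a => (∏ j, ((ibinom (x j) (δ j) : ℤ) : R)) * a) =
      ∑ δ ∈ S, (∏ j, ((ibinom (x j) (δ j) : ℤ) : R)) * g δ :=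
  Finsupp.onFinset_sum _ (by simp)

/-- Arithmetic of the degree bound. -/
theorem prod_vanish {n : ℕ} (p : ℕ) (hp : p.Prime) (a : Fin n → ℕ) (β : ℕ) (M : ℕ)
    (hM : ∀ j, a j ≤ M) (hβ : 1 ≤ β) (ψ : Fin n → ℕ → ZMod (p ^ β))
    (hψ : ∀ j k δ, p ^ (a j + 1) + k * ((p - 1) * p ^ a j) ≤ δ →
      ((p : ZMod (p ^ β)) ^ (k + 1)) ∣ ψ j δ)
    (δ : Fin n → ℕ)
    (hδ : (∑ j, (p ^ (a j + 1) - 1)) + (β - 1) * ((p - 1) * p ^ M) < ∑ j, δ j) :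
    ∏ j, ψ j (δ j) = 0 := by
  have hk : ∀ j, ∃ k, δ j ≤ p ^ (a j + 1) - 1 + k * ((p - 1) * p ^ a j) ∧
      ((p : ZMod (p ^ β)) ^ k) ∣ ψ j (δ j) := by
    intro j
    have hpos : 0 < p ^ (a j + 1) := Nat.pow_pos hp.pos
    have hex : ∃ k, δ j ≤ p ^ (a j + 1) - 1 + k * ((p - 1) * p ^ a j) := by
      refine ⟨δ j, ?_⟩
      have : 1 ≤ (p - 1) * p ^ a j := Nat.mul_pos (by have := hp.two_le; omega) (Nat.pow_pos hp.pos)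
      nlinarith [Nat.zero_le (p ^ (a j + 1) - 1)]
    classical
    refine ⟨Nat.find hex, Nat.find_spec hex, ?_⟩
    rcases hkk : Nat.find hex with _ | k
    · simp
    · apply hψ
      have := Nat.find_min hex (m := k) (by omega)
      omega
  choose k hk1 hk2 using hk
  have hdvd : (p : ZMod (p ^ β)) ^ (∑ j, k j) ∣ ∏ j, ψ j (δ j) := by
    rw [← Finset.prod_pow_eq_pow_sum]
    exact Finset.prod_dvd_prod_of_dvd _ _ fun j _ => hk2 j
  have hge : β ≤ ∑ j, k j := by
    by_contra! hlt
    have h1 : ∑ j, δ j ≤ ∑ j, (p ^ (a j + 1) - 1 + k j * ((p - 1) * p ^ M)) :=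
      Finset.sum_le_sum fun j _ => (hk1 j).trans (by
        have := Nat.pow_le_pow_right hp.pos (hM j)
        gcongr)
    rw [Finset.sum_add_distrib, ← Finset.sum_mul] at h1
    have h2 : (∑ j, k j) * ((p - 1) * p ^ M) ≤ (β - 1) * ((p - 1) * p ^ M) :=
      Nat.mul_le_mul_right _ (by omega)
    omega
  have h0 : (p : ZMod (p ^ β)) ^ β = 0 := by
    rw [← Nat.cast_pow]; exact ZMod.natCast_self _
  rw [← zero_dvd_iff, ← h0]
  exact (pow_dvd_pow _ hge).trans hdvd

theorem main_aux (p : ℕ) (hp : p.Prime) (n : ℕ) (a : Fin n → ℕ) (j0 : Fin n)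
    (hj0 : ∀ j, a j ≤ a j0) (β : ℕ) (hβ : 1 ≤ β) (D : ℕ)
    (hD : D = (∑ j, (p ^ (a j + 1) - 1)) + (β - 1) * ((p - 1) * p ^ a j0)) :
    (∀ f : (Fin n → ℤ) → ZMod (p ^ β),
      (∀ (x : Fin n → ℤ) (j : Fin n),
        f (Function.update x j (x j + (p ^ (a j + 1) : ℕ))) = f x) →
      ∃ c : (Fin n → ℕ) →₀ ZMod (p ^ β),
        (∀ x : Fin n → ℤ,
          f x = c.sum fun δ a => (∏ j, ((ibinom (x j) (δ j) : ℤ) : ZMod (p ^ β))) * a) ∧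
        ∀ δ : Fin n → ℕ, D < ∑ j, δ j → c δ = 0) ∧
    (∃ f : (Fin n → ℤ) → ZMod (p ^ β),
      (∀ (x : Fin n → ℤ) (j : Fin n),
        f (Function.update x j (x j + (p ^ (a j + 1) : ℕ))) = f x) ∧
      ∀ c : (Fin n → ℕ) →₀ ZMod (p ^ β),
        (∀ x : Fin n → ℤ,
          f x = c.sum fun δ a => (∏ j, ((ibinom (x j) (δ j) : ℤ) : ZMod (p ^ β))) * a) →
        ∃ δ : Fin n → ℕ, (∑ j, δ j) = D ∧ c δ ≠ 0) := by
  classical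
  haveI : NeZero p := ⟨hp.ne_zero⟩
  choose φ d h1 h2 h3 h4 h5 using fun j => oneD p hp (a j) β hβ
  constructor
  · intro f hf
    let F : (∀ j, ZMod (p ^ (a j + 1))) → ZMod (p ^ β) := fun b => f (fun j => ((b j).val : ℤ))
    have hF : ∀ x : Fin n → ℤ, f x = F (fun j => (x j : ZMod (p ^ (a j + 1)))) := by
      intro x
      simp only [F, ZMod.val_intCast]
      rw [← periodic_all _ f hf (fun j => x j % ((p ^ (a j + 1) : ℕ) : ℤ)) (fun j => x j / ((p ^ (a j + 1) : ℕ) : ℤ))]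
      congr 1
      funext j
      exact (Int.emod_add_mul_ediv _ _).symm
    refine ⟨Finsupp.onFinset (Fintype.piFinset (fun j => Finset.range (d j)))
      (fun δ => ∑ b : (∀ j, ZMod (p ^ (a j + 1))), F b * ∏ j, φ j (b j) (δ j)) ?_, ?_, ?_⟩
    · intro δ hδ
      by_contra hn
      apply hδ
      refine Finset.sum_eq_zero fun b _ => ?_
      rw [prod_supp d (fun j => φ j (b j)) (fun j => h1 j (b j)) δ hn, mul_zero]
    · intro x
      rw [onFinset_rep, hF]
      have e1 : F (fun j => (x j : ZMod (p ^ (a j + 1)))) = ∑ b : (∀ j, ZMod (p ^ (a j + 1))),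
          F b * ∏ j, (if (x j : ZMod (p ^ (a j + 1))) = b j then (1 : ZMod (p ^ β)) else 0) := by
        rw [Finset.sum_eq_single (fun j => (x j : ZMod (p ^ (a j + 1))))]
        · simp
        · intro b _ hb
          obtain ⟨j, hj⟩ := Function.ne_iff.1 hb
          rw [Finset.prod_eq_zero (Finset.mem_univ j), mul_zero]
          rw [if_neg (Ne.symm hj)]
        · simp
      rw [e1]
      simp only [h2]
      simp only [Finset.mul_sum]
      rw [Finset.sum_comm]
      refine Finset.sum_congr rfl fun b _ => ?_
      rw [prod_expand d (fun j => φ j (b j)), Finset.mul_sum]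
      refine Finset.sum_congr rfl fun δ _ => ?_
      ring
    · intro δ hδ
      rw [Finsupp.onFinset_apply]
      refine Finset.sum_eq_zero fun b _ => ?_
      rw [prod_vanish p hp a β (a j0) hj0 hβ (fun j => φ j (b j)) (fun j => h3 j (b j)) δ
        (hD ▸ hδ), mul_zero]
  · refine ⟨fun x => ∏ j, (if (x j : ZMod (p ^ (a j + 1))) = -1 then (1 : ZMod (p ^ β)) else 0),
      ?_, ?_⟩
    · intro x j
      refine Finset.prod_congr rfl fun i _ => ?_
      by_cases hi : i = j
      · subst hi
        rw [Function.update_self, Int.cast_add, Int.cast_natCast, ZMod.natCast_self, add_zero]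
      · rw [Function.update_of_ne hi]
    · intro c hc
      let c0 : (Fin n → ℕ) →₀ ZMod (p ^ β) :=
        Finsupp.onFinset (Fintype.piFinset (fun j => Finset.range (d j)))
          (fun δ => ∏ j, φ j (-1) (δ j)) (fun δ hδ => by
            by_contra hn
            exact hδ (prod_supp d (fun j => φ j (-1)) (fun j => h1 j (-1)) δ hn))
      have hc0 : c - c0 = 0 := by
        apply rep_unique
        intro x
        rw [Finsupp.sum_sub_index (fun _ _ _ => mul_sub _ _ _), ← hc, onFinset_rep,
          ← prod_expand d (fun j => φ j (-1))]
        simp only [h2, sub_self]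
      have hcc : c = c0 := sub_eq_zero.1 hc0
      refine ⟨fun j => p ^ (a j + 1) - 1 + (if j = j0 then (β - 1) * ((p - 1) * p ^ a j0) else 0),
        ?_, ?_⟩
      · rw [Finset.sum_add_distrib, hD]; simp
      · rw [hcc, Finsupp.onFinset_apply, Finset.prod_eq_single j0]
        · simp only [if_true]
          rw [h5]
          intro h
          have h6 : ((p ^ (β - 1) : ℕ) : ZMod (p ^ β)) = 0 := by
            rw [neg_pow] at h
            have h7 := congrArg (fun u => (-1) ^ (β - 1) * u) h
            simp only [← mul_assoc, ← mul_pow, mul_zero] at h7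
            simpa using h7
          rw [ZMod.natCast_eq_zero_iff, Nat.pow_dvd_pow_iff_le_right hp.one_lt] at h6
          omega
        · intro j _ hj
          simp only [if_neg hj, add_zero]
          rw [h4]
        · simp

/-- Total degree bound for periodic polyfracts: every function `ℤ^n → ZMod(p^β)` that is
`p^{α_j}`-periodic in the `j`-th variable has a polyfract representation supported in total
degree at most `D := Σ_j p^{α_j} − n + (β−1)(p−1)p^{α_max−1}`, and this bound is best
possible. -/
theorem stmt_12 (p : ℕ) (hp : p.Prime) (n : ℕ) (hn : 1 ≤ n) (α : Fin n → ℕ)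
    (hα : ∀ j, 1 ≤ α j) (β : ℕ) (hβ : 1 ≤ β)
    (D : ℕ)
    (hD : D = (∑ j, p ^ α j) - n + (β - 1) * (p - 1) * p ^ (Finset.univ.sup α - 1)) :
    (∀ f : (Fin n → ℤ) → ZMod (p ^ β),
      (∀ (x : Fin n → ℤ) (j : Fin n),
        f (Function.update x j (x j + p ^ α j)) = f x) →
      ∃ c : (Fin n → ℕ) →₀ ZMod (p ^ β),
        (∀ x : Fin n → ℤ,
          f x = c.sum fun δ a => (∏ j, ((ibinom (x j) (δ j) : ℤ) : ZMod (p ^ β))) * a) ∧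
        ∀ δ : Fin n → ℕ, D < ∑ j, δ j → c δ = 0) ∧
    (∃ f : (Fin n → ℤ) → ZMod (p ^ β),
      (∀ (x : Fin n → ℤ) (j : Fin n),
        f (Function.update x j (x j + p ^ α j)) = f x) ∧
      ∀ c : (Fin n → ℕ) →₀ ZMod (p ^ β),
        (∀ x : Fin n → ℤ,
          f x = c.sum fun δ a => (∏ j, ((ibinom (x j) (δ j) : ℤ) : ZMod (p ^ β))) * a) →
        ∃ δ : Fin n → ℕ, (∑ j, δ j) = D ∧ c δ ≠ 0) := by
  haveI : Nonempty (Fin n) := ⟨⟨0, hn⟩⟩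
  obtain ⟨j0, -, hj0⟩ := Finset.exists_mem_eq_sup Finset.univ Finset.univ_nonempty α
  obtain ⟨a, rfl⟩ : ∃ a : Fin n → ℕ, α = fun j => a j + 1 :=
    ⟨fun j => α j - 1, by funext j; have := hα j; simp only; omega⟩
  have hle : ∀ j, a j ≤ a j0 := by
    intro j
    have := Finset.le_sup (f := fun j => a j + 1) (Finset.mem_univ j)
    rw [hj0] at this
    simpa using this
  have hsum : ∑ j, (p ^ (a j + 1) - 1) = (∑ j, p ^ (a j + 1)) - n := by
    have : ∑ j, (p ^ (a j + 1) - 1) + n = ∑ j, p ^ (a j + 1) := by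
      have e : ∑ j, (p ^ (a j + 1) - 1 + 1) = ∑ j, p ^ (a j + 1) :=
        Finset.sum_congr rfl fun j _ => Nat.sub_add_cancel (Nat.pow_pos hp.pos)
      rw [← e, Finset.sum_add_distrib]
      simp
    omega
  have := main_aux p hp n a j0 hle β hβ D (by
    rw [hD, hj0, hsum, Nat.add_sub_cancel, mul_assoc])
  simpa only [Nat.cast_pow] using this
end
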